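/- Assume Γ is Q-polynomial with respect to E (the balanced set condition). Then for all distinct vertices x, y ∈ X with i = ∂(x,y): (1) E x⁻_y − E y⁻_x = c_i ((θ*_1 − θ*_{i-1}) / (θ*_0 − θ*_i)) (E x̂ − E ŷ), and (2) E x⁺_y − E y⁺_x = b_i ((θ*_1 − θ*_{i+1}) / (θ*_0 − θ*_i)) (E x̂ − E ŷ). -/

import Mathlib

open Matrix Finset
open scoped Classical

/-- A distance-regular graph `Γ` with vertex set `X`, path-length distance
`G.dist`, diameter `d ≥ 2`, and intersection numbers `p h i j`. -/
structure DRG where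
  X : Type
  [fin : Fintype X]
  [deceq : DecidableEq X]
  G : SimpleGraph X
  conn : G.Connected
  d : ℕ
  d_ge_two : 2 ≤ d
  dist_le : ∀ x y : X, G.dist x y ≤ d
  dist_attained : ∃ x y : X, G.dist x y = d
  p : ℕ → ℕ → ℕ → ℕ
  dist_regular : ∀ (h i j : ℕ) (x y : X), G.dist x y = h →
    (Finset.univ.filter fun z => G.dist x z = i ∧ G.dist y z = j).card = p h i j

attribute [instance] DRG.fin DRG.deceq

namespace DRG

variable (Γ : DRG)

/-- `Γ_i(x) = {z : ∂(x,z) = i}`. -/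
noncomputable def sphere (x : Γ.X) (i : ℕ) : Finset Γ.X :=
  Finset.univ.filter fun z => Γ.G.dist x z = i

/-- The number of vertices `|X|`, as a real number. -/
noncomputable def n : ℝ := (Fintype.card Γ.X : ℝ)

/-- The `i`-th distance matrix `A_i`. -/
noncomputable def Ai (i : ℕ) : Matrix Γ.X Γ.X ℝ :=
  Matrix.of fun x y => if Γ.G.dist x y = i then (1 : ℝ) else 0

/-- The adjacency matrix `A = A_1`. -/
noncomputable def A : Matrix Γ.X Γ.X ℝ := Γ.Ai 1

/-- The all-ones matrix `J`. -/
def Jmat : Matrix Γ.X Γ.X ℝ := Matrix.of fun _ _ => (1 : ℝ)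

/-- `c_i = p^i_{1,i-1}` (so `c_0 = 0`). -/
noncomputable def c (i : ℕ) : ℝ := (Γ.p i 1 (i - 1) : ℝ)

/-- `a_i = p^i_{1,i}`. -/
noncomputable def a (i : ℕ) : ℝ := (Γ.p i 1 i : ℝ)

/-- `b_i = p^i_{1,i+1}` (so `b_d = 0`). -/
noncomputable def b (i : ℕ) : ℝ := (Γ.p i 1 (i + 1) : ℝ)

/-- The standard basis vector `x̂`. -/
noncomputable def hatv (x : Γ.X) : Γ.X → ℝ := Pi.single x 1

/-- `x⁺_y = Σ_{z ∈ Γ(x) ∩ Γ_{i+1}(y)} ẑ` where `i = ∂(x,y)`. -/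
noncomputable def plusv (x y : Γ.X) : Γ.X → ℝ :=
  ∑ z ∈ Γ.sphere x 1 ∩ Γ.sphere y (Γ.G.dist x y + 1), Γ.hatv z

/-- `x⁰_y = Σ_{z ∈ Γ(x) ∩ Γ_i(y)} ẑ` where `i = ∂(x,y)`. -/
noncomputable def zerov (x y : Γ.X) : Γ.X → ℝ :=
  ∑ z ∈ Γ.sphere x 1 ∩ Γ.sphere y (Γ.G.dist x y), Γ.hatv z

/-- `x⁻_y = Σ_{z ∈ Γ(x) ∩ Γ_{i-1}(y)} ẑ` where `i = ∂(x,y)`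
(for `i = 0` this is the zero vector, matching `Γ_{-1}(y) = ∅`). -/
noncomputable def minusv (x y : Γ.X) : Γ.X → ℝ :=
  ∑ z ∈ Γ.sphere x 1 ∩ Γ.sphere y (Γ.G.dist x y - 1), Γ.hatv z

/-- The Norton product `u ⋆ v = E (u ∘ v)`, where `∘` is the entrywise
(Hadamard) product of vectors. -/
noncomputable def norton (E : Matrix Γ.X Γ.X ℝ) (u v : Γ.X → ℝ) : Γ.X → ℝ :=
  E *ᵥ (u * v)

/-- `E 0, …, E d` is the sequence of primitive idempotents of the Bose–Mesner
algebra, with `E 0 = |X|⁻¹ J`, and `θ 0, …, θ d` are the corresponding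
(mutually distinct) eigenvalues, so that `A = Σ_i θ i • E i`. -/
def IsPrimIdemSeq (E : ℕ → Matrix Γ.X Γ.X ℝ) (θ : ℕ → ℝ) : Prop :=
  E 0 = (Γ.n)⁻¹ • Γ.Jmat ∧
  ∑ i ∈ Finset.range (Γ.d + 1), E i = 1 ∧
  (∀ i j : ℕ, i ≤ Γ.d → j ≤ Γ.d → E i * E j = if i = j then E i else 0) ∧
  Γ.A = ∑ i ∈ Finset.range (Γ.d + 1), θ i • E i ∧
  (∀ i j : ℕ, i ≤ Γ.d → j ≤ Γ.d → θ i = θ j → i = j)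

/-- `q h i j` are the Krein parameters:
`E i ∘ E j = |X|⁻¹ Σ_h q h i j • E h`, with `∘` the entrywise product. -/
def IsKrein (E : ℕ → Matrix Γ.X Γ.X ℝ) (q : ℕ → ℕ → ℕ → ℝ) : Prop :=
  ∀ i j : ℕ, i ≤ Γ.d → j ≤ Γ.d →
    Matrix.hadamard (E i) (E j) =
      (Γ.n)⁻¹ • ∑ h ∈ Finset.range (Γ.d + 1), q h i j • E h

/-- The ordering `E 1, …, E d` is `Q`-polynomial: for `0 ≤ h,i,j ≤ d`,
`q h i j = 0` if one of `h,i,j` is greater than the sum of the other two, and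
`q h i j ≠ 0` if one of `h,i,j` equals the sum of the other two. -/
def IsQPolynomial (q : ℕ → ℕ → ℕ → ℝ) : Prop :=
  ∀ h i j : ℕ, h ≤ Γ.d → i ≤ Γ.d → j ≤ Γ.d →
    ((i + j < h ∨ h + j < i ∨ h + i < j) → q h i j = 0) ∧
    ((h = i + j ∨ i = h + j ∨ j = h + i) → q h i j ≠ 0)

/-- `ts 0, …, ts d` are the (mutually distinct) dual eigenvalues associated
with `E`, i.e. `E = |X|⁻¹ Σ_i ts i • A i`.  The values `ts (-1)` and
`ts (d+1)` are arbitrary reals (indeterminates). -/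
def IsDualEigs (E : Matrix Γ.X Γ.X ℝ) (ts : ℤ → ℝ) : Prop :=
  E = (Γ.n)⁻¹ • ∑ i ∈ Finset.range (Γ.d + 1), ts i • Γ.Ai i

/-- The dual eigenvalues `ts 0, …, ts d` are mutually distinct. -/
def DualDistinct (ts : ℤ → ℝ) : Prop :=
  ∀ i j : ℕ, i ≤ Γ.d → j ≤ Γ.d → ts i = ts j → i = j

/-- `C(x,y) = E x⁻_y − c_i ((θ*_1 − θ*_{i-1})/(θ*_0 − θ*_i)) E x̂`,
where `i = ∂(x,y)`. -/
noncomputable def Cvec (E : Matrix Γ.X Γ.X ℝ) (ts : ℤ → ℝ) (x y : Γ.X) :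
    Γ.X → ℝ :=
  E *ᵥ Γ.minusv x y -
    (Γ.c (Γ.G.dist x y) *
      ((ts 1 - ts ((Γ.G.dist x y : ℤ) - 1)) / (ts 0 - ts (Γ.G.dist x y)))) •
      (E *ᵥ Γ.hatv x)

/-- `B(x,y) = E x⁺_y − b_i ((θ*_1 − θ*_{i+1})/(θ*_0 − θ*_i)) E x̂`,
where `i = ∂(x,y)`. -/
noncomputable def Bvec (E : Matrix Γ.X Γ.X ℝ) (ts : ℤ → ℝ) (x y : Γ.X) :
    Γ.X → ℝ :=
  E *ᵥ Γ.plusv x y -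
    (Γ.b (Γ.G.dist x y) *
      ((ts 1 - ts ((Γ.G.dist x y : ℤ) + 1)) / (ts 0 - ts (Γ.G.dist x y)))) •
      (E *ᵥ Γ.hatv x)

end DRG

namespace DRG

variable {Γ : DRG} {E : ℕ → Matrix Γ.X Γ.X ℝ} {θ : ℕ → ℝ} {q : ℕ → ℕ → ℕ → ℝ} {ts : ℤ → ℝ}

theorem n_ne_zero (Γ : DRG) : Γ.n ≠ 0 := by
  obtain ⟨x, -⟩ := Γ.dist_attained
  have : Nonempty Γ.X := ⟨x⟩
  simp [n]

theorem Ai_apply (i : ℕ) (x y : Γ.X) :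
    Γ.Ai i x y = if Γ.G.dist x y = i then (1 : ℝ) else 0 := rfl

theorem transpose_Ai (i : ℕ) : (Γ.Ai i)ᵀ = Γ.Ai i := by
  ext x y
  simp [Ai_apply, SimpleGraph.dist_comm]

theorem Ai_eq_zero {i : ℕ} (hi : Γ.d < i) : Γ.Ai i = 0 := by
  ext x y
  have := Γ.dist_le x y
  rw [Ai_apply, if_neg (by omega), Matrix.zero_apply]

theorem IsPrimIdemSeq.mul_sum (hE : Γ.IsPrimIdemSeq E θ) (r : ℕ → ℝ) {i : ℕ} (hi : i ≤ Γ.d) :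
    E i * ∑ j ∈ Finset.range (Γ.d + 1), r j • E j = r i • E i := by
  obtain ⟨-, -, hmul, -, -⟩ := hE
  rw [Finset.mul_sum, Finset.sum_eq_single i]
  · rw [Matrix.mul_smul, hmul i i hi hi, if_pos rfl]
  · intro j hj hji
    rw [Matrix.mul_smul, hmul i j hi (by simpa [Nat.lt_succ_iff] using hj), if_neg (Ne.symm hji),
      smul_zero]
  · intro h
    exact absurd (Finset.mem_range.2 (Nat.lt_succ_of_le hi)) h

theorem IsPrimIdemSeq.sum_mul (hE : Γ.IsPrimIdemSeq E θ) (r : ℕ → ℝ) {i : ℕ} (hi : i ≤ Γ.d) :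
    (∑ j ∈ Finset.range (Γ.d + 1), r j • E j) * E i = r i • E i := by
  obtain ⟨-, -, hmul, -, -⟩ := hE
  rw [Finset.sum_mul, Finset.sum_eq_single i]
  · rw [Matrix.smul_mul, hmul i i hi hi, if_pos rfl]
  · intro j hj hji
    rw [Matrix.smul_mul, hmul j i (by simpa [Nat.lt_succ_iff] using hj) hi, if_neg hji, smul_zero]
  · intro h
    exact absurd (Finset.mem_range.2 (Nat.lt_succ_of_le hi)) h

/-- The primitive idempotents are symmetric matrices. -/
theorem IsPrimIdemSeq.transpose_eq (hE : Γ.IsPrimIdemSeq E θ) {i : ℕ} (hi : i ≤ Γ.d) :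
    (E i)ᵀ = E i := by
  obtain ⟨-, hone, -, hA, hinj⟩ := id hE
  have hAE : ∀ j ≤ Γ.d, Γ.A * E j = θ j • E j := fun j hj => by rw [hA, hE.sum_mul θ hj]
  have hEA : (E i)ᵀ * Γ.A = θ i • (E i)ᵀ := by
    have h := congrArg Matrix.transpose (hAE i hi)
    rwa [Matrix.transpose_mul, Matrix.transpose_smul, A, transpose_Ai] at h
  have horth : ∀ j ≤ Γ.d, j ≠ i → (E i)ᵀ * E j = 0 := by
    intro j hj hji
    have h : θ i • ((E i)ᵀ * E j) = θ j • ((E i)ᵀ * E j) := by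
      rw [← Matrix.smul_mul, ← hEA, Matrix.mul_assoc, hAE j hj, Matrix.mul_smul]
    rw [← sub_eq_zero, ← sub_smul] at h
    rcases smul_eq_zero.1 h with h | h
    · exact absurd (hinj i j hi hj (sub_eq_zero.1 h)).symm hji
    · exact h
  have hself : (E i)ᵀ = (E i)ᵀ * E i := by
    conv_lhs => rw [← Matrix.mul_one (E i)ᵀ, ← hone, Finset.mul_sum]
    refine Finset.sum_eq_single i (fun j hj hji => ?_) fun h => ?_
    · exact horth j (by simpa [Nat.lt_succ_iff] using hj) hji
    · exact absurd (Finset.mem_range.2 (Nat.lt_succ_of_le hi)) h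
  have h := congrArg Matrix.transpose hself
  rw [Matrix.transpose_mul, Matrix.transpose_transpose, ← hself] at h
  exact h.symm

/-- Matrices of the form `Σ_i r i • E i`. -/
def idemSpan (Γ : DRG) (E : ℕ → Matrix Γ.X Γ.X ℝ) : Submodule ℝ (Matrix Γ.X Γ.X ℝ) :=
  Submodule.span ℝ (E '' Set.Iic Γ.d)

theorem exists_coeff_of_mem_idemSpan {S : Matrix Γ.X Γ.X ℝ} (hS : S ∈ Γ.idemSpan E) :
    ∃ s : ℕ → ℝ, S = ∑ j ∈ Finset.range (Γ.d + 1), s j • E j := by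
  induction hS using Submodule.span_induction with
  | mem S hS =>
    obtain ⟨i, hi, rfl⟩ := hS
    refine ⟨Pi.single i 1, ?_⟩
    rw [Finset.sum_eq_single i]
    · simp
    · intro j _ hji
      simp [hji]
    · intro h
      exact absurd (Finset.mem_range.2 (Nat.lt_succ_of_le hi)) h
  | zero => exact ⟨0, by simp⟩
  | add S T _ _ hS hT =>
    obtain ⟨s, rfl⟩ := hS
    obtain ⟨t, rfl⟩ := hT
    exact ⟨s + t, by simp [add_smul, Finset.sum_add_distrib]⟩
  | smul a S _ hS =>
    obtain ⟨s, rfl⟩ := hS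
    exact ⟨a • s, by simp [Finset.smul_sum, smul_smul]⟩

theorem mem_idemSpan {i : ℕ} (hi : i ≤ Γ.d) : E i ∈ Γ.idemSpan E :=
  Submodule.subset_span ⟨i, hi, rfl⟩

theorem IsKrein.hadamard_mem (hq : Γ.IsKrein E q) {S T : Matrix Γ.X Γ.X ℝ}
    (hS : S ∈ Γ.idemSpan E) (hT : T ∈ Γ.idemSpan E) :
    Matrix.hadamard S T ∈ Γ.idemSpan E := by
  induction hS using Submodule.span_induction with
  | mem S hS =>
    obtain ⟨i, hi, rfl⟩ := hS
    induction hT using Submodule.span_induction with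
    | mem T hT =>
      obtain ⟨j, hj, rfl⟩ := hT
      rw [hq i j hi hj]
      exact Submodule.smul_mem _ _ (Submodule.sum_mem _ fun h hh =>
        Submodule.smul_mem _ _ (mem_idemSpan (by simpa [Nat.lt_succ_iff] using hh)))
    | zero => simp
    | add T U _ _ hT hU => rw [Matrix.hadamard_add]; exact add_mem hT hU
    | smul a T _ hT => rw [Matrix.hadamard_smul]; exact Submodule.smul_mem _ _ hT
  | zero => simp
  | add S U _ _ hS hU => rw [Matrix.add_hadamard]; exact add_mem hS hU
  | smul a S _ hS => rw [Matrix.smul_hadamard]; exact Submodule.smul_mem _ _ hS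

theorem IsPrimIdemSeq.const_mem (hE : Γ.IsPrimIdemSeq E θ) (a : ℝ) :
    (Matrix.of fun _ _ => a) ∈ Γ.idemSpan E := by
  have h : (Matrix.of fun _ _ => a : Matrix Γ.X Γ.X ℝ) = (a * Γ.n) • E 0 := by
    ext x y
    simp [hE.1, Jmat, n_ne_zero Γ]
  rw [h]
  exact Submodule.smul_mem _ _ (mem_idemSpan (Nat.zero_le _))

/-- Entrywise polynomial functions of a matrix in the span of the primitive idempotents remain in
that span. -/
theorem IsPrimIdemSeq.eval_mem (hE : Γ.IsPrimIdemSeq E θ) (hq : Γ.IsKrein E q)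
    {S : Matrix Γ.X Γ.X ℝ} (hS : S ∈ Γ.idemSpan E) (f : Polynomial ℝ) :
    S.map (fun t => f.eval t) ∈ Γ.idemSpan E := by
  induction f using Polynomial.induction_on' with
  | add f g hf hg =>
    convert add_mem hf hg using 1
    ext x y
    simp
  | monomial k a =>
    induction k with
    | zero =>
      convert hE.const_mem a using 1
      ext x y
      simp
    | succ k ih =>
      convert hq.hadamard_mem ih hS using 1
      ext x y
      simp [pow_succ, mul_assoc]

theorem IsDualEigs.apply (hts : Γ.IsDualEigs (E 1) ts) (x y : Γ.X) :
    E 1 x y = Γ.n⁻¹ * ts (Γ.G.dist x y) := by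
  have hd := Γ.dist_le x y
  rw [hts]
  simp [Matrix.sum_apply, Ai_apply, Finset.sum_ite_eq, hd]

/-- Every distance matrix is a linear combination of the primitive idempotents. -/
theorem IsPrimIdemSeq.Ai_mem (hE : Γ.IsPrimIdemSeq E θ) (hq : Γ.IsKrein E q)
    (hts : Γ.IsDualEigs (E 1) ts) (hts' : Γ.DualDistinct ts) (i : ℕ) :
    Γ.Ai i ∈ Γ.idemSpan E := by
  rcases lt_or_ge Γ.d i with hi | hi
  · rw [Ai_eq_zero hi]
    exact zero_mem _
  have h1 : 1 ≤ Γ.d := le_trans one_le_two Γ.d_ge_two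
  have hinj : Set.InjOn (fun j : ℕ => ts j) (Finset.range (Γ.d + 1) : Set ℕ) := by
    intro j hj k hk hjk
    simp only [Finset.coe_range, Set.mem_Iio, Nat.lt_succ_iff] at hj hk
    exact hts' j k hj hk hjk
  convert hE.eval_mem hq (Submodule.smul_mem _ Γ.n (mem_idemSpan (E := E) h1))
    (Lagrange.basis (Finset.range (Γ.d + 1)) (fun j : ℕ => ts j) i) using 1
  ext x y
  have hval : Γ.n * E 1 x y = ts (Γ.G.dist x y) := by
    rw [hts.apply, mul_inv_cancel_left₀ (n_ne_zero Γ)]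
  have hi' : i ∈ Finset.range (Γ.d + 1) := Finset.mem_range.2 (Nat.lt_succ_of_le hi)
  have hd' : Γ.G.dist x y ∈ Finset.range (Γ.d + 1) :=
    Finset.mem_range.2 (Nat.lt_succ_of_le (Γ.dist_le x y))
  rw [Matrix.map_apply, Matrix.smul_apply, smul_eq_mul, hval, Ai_apply]
  split_ifs with h
  · rw [h]
    exact (Lagrange.eval_basis_self hinj hi').symm
  · exact (Lagrange.eval_basis_of_ne (v := fun j : ℕ => ts j) (Ne.symm h) hd').symm

/-- The vanishing of `q 1 i j` forces `E i * A*(u) * E j = 0`, where `A*(u)` is a multiple of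
`diagonal (E 1 u)`. -/
theorem IsPrimIdemSeq.mul_diagonal_mul_eq_zero (hE : Γ.IsPrimIdemSeq E θ) (hq : Γ.IsKrein E q)
    {i j : ℕ} (hi : i ≤ Γ.d) (hj : j ≤ Γ.d) (h : q 1 i j = 0) (u : Γ.X) :
    E i * Matrix.diagonal (E 1 u) * E j = 0 := by
  have h1 : 1 ≤ Γ.d := le_trans one_le_two Γ.d_ge_two
  set D := Matrix.diagonal (E 1 u) with hD
  have hsymm : ∀ {k : ℕ}, k ≤ Γ.d → ∀ v w, E k v w = E k w v := fun hk v w =>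
    congrFun (congrFun (hE.transpose_eq hk) w) v
  have hidem : ∀ {k : ℕ}, k ≤ Γ.d → E k * E k = E k := fun hk => by
    rw [hE.2.2.1 _ _ hk hk, if_pos rfl]
  have hquad : E 1 * Matrix.hadamard (E i) (E j) * E 1 = 0 := by
    rw [hq i j hi hj, Matrix.mul_smul, hE.mul_sum (fun k => q k i j) h1, h]
    simp
  rw [← Matrix.trace_conjTranspose_mul_self_eq_zero_iff]
  have hstar : (E i * D * E j)ᴴ = E j * D * E i := by
    simp only [Matrix.conjTranspose_eq_transpose_of_trivial, Matrix.transpose_mul,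
      hE.transpose_eq hi, hE.transpose_eq hj, hD, Matrix.diagonal_transpose, Matrix.mul_assoc]
  have hprod : Matrix.trace (E j * D * E i * (E i * D * E j)) =
      Matrix.trace (D * E i * (D * E j)) := by
    calc Matrix.trace (E j * D * E i * (E i * D * E j))
        = Matrix.trace (E j * (D * (E i * E i) * D * E j)) := by simp only [Matrix.mul_assoc]
      _ = Matrix.trace (D * (E i * E i) * D * (E j * E j)) := by
          rw [Matrix.trace_mul_comm]; simp only [Matrix.mul_assoc]
      _ = _ := by rw [hidem hi, hidem hj]; simp only [Matrix.mul_assoc]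
  rw [hstar, hprod]
  have hentry := congrFun (congrFun hquad u) u
  rw [Matrix.zero_apply] at hentry
  rw [← hentry]
  have hDE : ∀ (k : ℕ) (v w : Γ.X), (D * E k) v w = E 1 u v * E k v w := fun k v w =>
    Matrix.diagonal_mul _ _ _ _
  simp only [Matrix.trace, Matrix.diag_apply, Matrix.mul_apply (M := D * E i), hDE]
  simp only [Matrix.mul_apply, Matrix.hadamard_apply, Finset.sum_mul]
  rw [Finset.sum_comm]
  refine Finset.sum_congr rfl fun v _ => Finset.sum_congr rfl fun w _ => ?_
  rw [hsymm h1 v u, hsymm hj v w]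
  ring

/-- For `R`, `S` in the Bose–Mesner algebra there is `Y` with
`R A* S - S A* R = Y A* - A* Y` for every dual adjacency matrix `A*`. -/
theorem IsPrimIdemSeq.exists_commutator (hE : Γ.IsPrimIdemSeq E θ) (hq : Γ.IsKrein E q)
    (hQ : Γ.IsQPolynomial q) {R S : Matrix Γ.X Γ.X ℝ} (hR : R ∈ Γ.idemSpan E)
    (hS : S ∈ Γ.idemSpan E) :
    ∃ Y : Matrix Γ.X Γ.X ℝ, ∀ u : Γ.X,
      R * Matrix.diagonal (E 1 u) * S - S * Matrix.diagonal (E 1 u) * R =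
        Y * Matrix.diagonal (E 1 u) - Matrix.diagonal (E 1 u) * Y := by
  have h1 : 1 ≤ Γ.d := le_trans one_le_two Γ.d_ge_two
  obtain ⟨r, rfl⟩ := exists_coeff_of_mem_idemSpan hR
  obtain ⟨s, rfl⟩ := exists_coeff_of_mem_idemSpan hS
  let y : ℕ → ℝ := fun i => -∑ k ∈ Finset.range i, (r k * s (k + 1) - s k * r (k + 1))
  have hy : ∀ i, y i - y (i + 1) = r i * s (i + 1) - s i * r (i + 1) := by
    intro i
    simp only [y, Finset.sum_range_succ]
    ring
  refine ⟨∑ j ∈ Finset.range (Γ.d + 1), y j • E j, fun u => ?_⟩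
  set D := Matrix.diagonal (E 1 u) with hD
  have hexp : ∀ f g : ℕ → ℝ,
      (∑ i ∈ Finset.range (Γ.d + 1), f i • E i) * D * ∑ j ∈ Finset.range (Γ.d + 1), g j • E j =
        ∑ i ∈ Finset.range (Γ.d + 1), ∑ j ∈ Finset.range (Γ.d + 1),
          (f i * g j) • (E i * D * E j) := by
    intro f g
    simp only [Finset.sum_mul, Finset.mul_sum, Matrix.smul_mul, Matrix.mul_smul, smul_smul]
    rw [Finset.sum_comm]
    refine Finset.sum_congr rfl fun i _ => Finset.sum_congr rfl fun j _ => ?_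
    rw [mul_comm]
  have hone : (∑ i ∈ Finset.range (Γ.d + 1), (1 : ℝ) • E i) = 1 := by
    simpa using hE.2.1
  have hl := hexp y fun _ => 1
  have hr := hexp (fun _ => 1) y
  rw [hone, Matrix.mul_one] at hl
  rw [hone, Matrix.one_mul] at hr
  rw [hl, hr, hexp, hexp, ← Finset.sum_sub_distrib, ← Finset.sum_sub_distrib]
  refine Finset.sum_congr rfl fun i hi => ?_
  rw [← Finset.sum_sub_distrib, ← Finset.sum_sub_distrib]
  refine Finset.sum_congr rfl fun j hj => ?_
  rw [Finset.mem_range, Nat.lt_succ_iff] at hi hj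
  rw [← sub_smul, ← sub_smul]
  by_cases hij : 1 + j < i ∨ 1 + i < j
  · have h0 : q 1 i j = 0 := (hQ 1 i j h1 hi hj).1 (Or.inr hij)
    rw [hE.mul_diagonal_mul_eq_zero hq hi hj h0 u, smul_zero, smul_zero]
  · congr 1
    obtain rfl | rfl | rfl : i = j ∨ j = i + 1 ∨ i = j + 1 := by omega
    · ring
    · linarith [hy i]
    · linarith [hy j]

/-- The balanced set condition for the pair of distances `(1, j)`. -/
theorem IsPrimIdemSeq.balanced (hE : Γ.IsPrimIdemSeq E θ) (hq : Γ.IsKrein E q)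
    (hQ : Γ.IsQPolynomial q) (hts : Γ.IsDualEigs (E 1) ts) (hts' : Γ.DualDistinct ts)
    {x y : Γ.X} (hxy : x ≠ y) (j : ℕ) :
    E 1 *ᵥ (∑ z ∈ Γ.sphere x 1 ∩ Γ.sphere y j, Γ.hatv z) -
        E 1 *ᵥ (∑ z ∈ Γ.sphere y 1 ∩ Γ.sphere x j, Γ.hatv z) =
      ((Γ.p (Γ.G.dist x y) 1 j : ℝ) * ((ts 1 - ts j) / (ts 0 - ts (Γ.G.dist x y)))) •
        (E 1 *ᵥ Γ.hatv x - E 1 *ᵥ Γ.hatv y) := by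
  obtain ⟨Y, hY⟩ := hE.exists_commutator hq hQ (hE.Ai_mem hq hts hts' 1)
    (hE.Ai_mem hq hts hts' j)
  have hpos := Γ.conn.pos_dist_of_ne hxy
  have hvec : ∀ (s : Finset Γ.X) (u : Γ.X),
      (E 1 *ᵥ ∑ z ∈ s, Γ.hatv z) u = ∑ z ∈ s, E 1 u z := by
    intro s u
    simp [hatv, Matrix.mulVec_sum, Matrix.mulVec_single]
  have hhat : ∀ z u : Γ.X, (E 1 *ᵥ Γ.hatv z) u = E 1 u z := by
    intro z u
    simp [hatv, Matrix.mulVec_single]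
  have hinter : ∀ (v w : Γ.X) (k l : ℕ) (f : Γ.X → ℝ),
      ∑ z ∈ Γ.sphere v k ∩ Γ.sphere w l, f z =
        ∑ z, (if Γ.G.dist v z = k then (1 : ℝ) else 0) * f z *
          (if Γ.G.dist z w = l then 1 else 0) := by
    intro v w k l f
    rw [sphere, sphere, ← Finset.filter_and, Finset.sum_filter]
    refine Finset.sum_congr rfl fun z _ => ?_
    rw [Γ.G.dist_comm (u := z) (v := w)]
    by_cases h : Γ.G.dist v z = k <;> by_cases h' : Γ.G.dist w z = l <;> simp [h, h']
  have hbal : ∀ u : Γ.X,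
      ∑ z ∈ Γ.sphere x 1 ∩ Γ.sphere y j, E 1 u z - ∑ z ∈ Γ.sphere y 1 ∩ Γ.sphere x j, E 1 u z =
        -Y x y * (E 1 u x - E 1 u y) := by
    intro u
    have h := congrFun (congrFun (hY u) x) y
    simp only [Matrix.sub_apply, Matrix.mul_diagonal, Matrix.diagonal_mul] at h
    rw [Matrix.mul_apply, Matrix.mul_apply] at h
    simp only [Matrix.mul_diagonal, Ai_apply] at h
    rw [Finset.inter_comm (Γ.sphere y 1), hinter, hinter, h]
    ring
  have hcard : ∀ v w : Γ.X, Γ.G.dist v w = Γ.G.dist x y →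
      (Γ.sphere v 1 ∩ Γ.sphere w j).card = Γ.p (Γ.G.dist x y) 1 j := by
    intro v w h
    rw [sphere, sphere, ← Finset.filter_and]
    exact Γ.dist_regular _ 1 j v w h
  have hcoef : -Y x y =
      (Γ.p (Γ.G.dist x y) 1 j : ℝ) * ((ts 1 - ts j) / (ts 0 - ts (Γ.G.dist x y))) := by
    have hne : ts 0 - ts (Γ.G.dist x y) ≠ 0 := by
      intro h
      have := hts' 0 _ (Nat.zero_le _) (Γ.dist_le x y) (by simpa using sub_eq_zero.1 h)
      omega
    have h := hbal x
    have h₁ : ∑ z ∈ Γ.sphere x 1 ∩ Γ.sphere y j, E 1 x z =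
        Γ.p (Γ.G.dist x y) 1 j * (Γ.n⁻¹ * ts 1) := by
      rw [← hcard x y rfl, ← nsmul_eq_mul, ← Finset.sum_const]
      refine Finset.sum_congr rfl fun z hz => ?_
      simp only [sphere, Finset.mem_inter, Finset.mem_filter] at hz
      rw [hts.apply, hz.1.2, Nat.cast_one]
    have h₂ : ∑ z ∈ Γ.sphere y 1 ∩ Γ.sphere x j, E 1 x z =
        Γ.p (Γ.G.dist x y) 1 j * (Γ.n⁻¹ * ts j) := by
      rw [← hcard y x Γ.G.dist_comm, ← nsmul_eq_mul, ← Finset.sum_const]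
      refine Finset.sum_congr rfl fun z hz => ?_
      simp only [sphere, Finset.mem_inter, Finset.mem_filter] at hz
      rw [hts.apply, hz.2.2]
    rw [h₁, h₂, hts.apply, hts.apply, SimpleGraph.dist_self, Nat.cast_zero] at h
    have hn := n_ne_zero Γ
    field_simp at h ⊢
    linarith
  funext u
  rw [Pi.sub_apply, Pi.smul_apply, Pi.sub_apply, hvec, hvec, hhat, hhat, hbal, hcoef, smul_eq_mul]

end DRG

/-- balanced set condition. -/
theorem DRG.balanced_set_condition (Γ : DRG) (E : ℕ → Matrix Γ.X Γ.X ℝ) (θ : ℕ → ℝ)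
    (hE : Γ.IsPrimIdemSeq E θ)
    (q : ℕ → ℕ → ℕ → ℝ) (hq : Γ.IsKrein E q) (hQ : Γ.IsQPolynomial q)
    (ts : ℤ → ℝ) (hts : Γ.IsDualEigs (E 1) ts) (hts' : Γ.DualDistinct ts) (x y : Γ.X)
    (hxy : x ≠ y) :
    (E 1 *ᵥ Γ.minusv x y - E 1 *ᵥ Γ.minusv y x =
      (Γ.c (Γ.G.dist x y) *
          ((ts 1 - ts ((Γ.G.dist x y : ℤ) - 1)) /
            (ts 0 - ts (Γ.G.dist x y)))) •
        (E 1 *ᵥ Γ.hatv x - E 1 *ᵥ Γ.hatv y)) ∧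
    (E 1 *ᵥ Γ.plusv x y - E 1 *ᵥ Γ.plusv y x =
      (Γ.b (Γ.G.dist x y) *
          ((ts 1 - ts ((Γ.G.dist x y : ℤ) + 1)) /
            (ts 0 - ts (Γ.G.dist x y)))) •
        (E 1 *ᵥ Γ.hatv x - E 1 *ᵥ Γ.hatv y)) := by
  have hpos := Γ.conn.pos_dist_of_ne hxy
  constructor
  · have h := hE.balanced hq hQ hts hts' hxy (Γ.G.dist x y - 1)
    rw [Nat.cast_sub hpos, Nat.cast_one] at h
    rw [minusv, minusv, Γ.G.dist_comm (u := y) (v := x)]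
    exact h
  · have h := hE.balanced hq hQ hts hts' hxy (Γ.G.dist x y + 1)
    rw [Nat.cast_add, Nat.cast_one] at h
    rw [plusv, plusv, Γ.G.dist_comm (u := y) (v := x)]
    exact h
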